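/- Let μ be the pre-Lie multiplication on ℂ² given by e2·e1 = e1 (algebra C04), and let ν be any bilinear map on ℂ² such that (ℂ², μ, ν) is a compatible pre-Lie algebra. Then (ℂ², μ, ν) is isomorphic as a compatible pre-Lie algebra to one of the following algebras, each with first multiplication μ and second multiplication ∗ as listed (α, β ∈ ℂ): C20^{α,β}: e2∗e1 = α e1, e2∗e2 = e1 + β e2; C21^{α,β}: e2∗e1 = α e1, e2∗e2 = β e2; C22^{α,β} with α ≠ 0: e1∗e2 = α e1, e2∗e1 = β e1, e2∗e2 = e1 + α e2; C23^{α,β} with α ≠ 0: e1∗e2 = α e1, e2∗e1 = β e1, e2∗e2 = α e2. -/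

import Mathlib

open scoped BigOperators

/-- The underlying vector space `ℂ²`. -/
abbrev V2 : Type := Fin 2 → ℂ

/-- The first standard basis vector of `ℂ²`. -/
noncomputable def e1 : V2 := ![1, 0]

/-- The second standard basis vector of `ℂ²`. -/
noncomputable def e2 : V2 := ![0, 1]

/-- The bilinear multiplication on `ℂ²` with multiplication table `f`,
i.e. the product of the `i`-th and `j`-th basis vectors is `f i j`. -/
noncomputable def bil (f : Fin 2 → Fin 2 → V2) : V2 →ₗ[ℂ] V2 →ₗ[ℂ] V2 :=
  LinearMap.mk₂ ℂ (fun x y => ∑ i : Fin 2, ∑ j : Fin 2, (x i * y j) • f i j)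
    (fun x x' y => by
      simp only [Pi.add_apply, add_mul, add_smul, Finset.sum_add_distrib])
    (fun c x y => by
      simp only [Pi.smul_apply, smul_eq_mul, Finset.smul_sum, smul_smul]
      refine Finset.sum_congr rfl fun i _ => Finset.sum_congr rfl fun j _ => ?_
      congr 1
      ring)
    (fun x y y' => by
      simp only [Pi.add_apply, mul_add, add_smul, Finset.sum_add_distrib])
    (fun c x y => by
      simp only [Pi.smul_apply, smul_eq_mul, Finset.smul_sum, smul_smul]
      refine Finset.sum_congr rfl fun i _ => Finset.sum_congr rfl fun j _ => ?_
      congr 1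
      ring)

/-- A bilinear map is a pre-Lie multiplication if it satisfies the (right)
pre-Lie identity. -/
def IsPreLie {V : Type*} [AddCommGroup V] [Module ℂ V]
    (μ : V →ₗ[ℂ] V →ₗ[ℂ] V) : Prop :=
  ∀ x y z : V, μ (μ x y) z - μ x (μ y z) = μ (μ y x) z - μ y (μ x z)

/-- `(V, μ, ν)` is a compatible pre-Lie algebra: `μ`, `ν` and `μ + ν` are all
pre-Lie multiplications. -/
def IsCompatPreLie {V : Type*} [AddCommGroup V] [Module ℂ V]
    (μ ν : V →ₗ[ℂ] V →ₗ[ℂ] V) : Prop :=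
  IsPreLie μ ∧ IsPreLie ν ∧ IsPreLie (μ + ν)

/-- Isomorphism of the two-multiplication algebras `(ℂ², μ, ν)` and `(ℂ², μ', ν')`. -/
def CompatIso (μ ν μ' ν' : V2 →ₗ[ℂ] V2 →ₗ[ℂ] V2) : Prop :=
  ∃ φ : V2 ≃ₗ[ℂ] V2, (∀ x y : V2, φ (μ x y) = μ' (φ x) (φ y)) ∧
    (∀ x y : V2, φ (ν x y) = ν' (φ x) (φ y))

/-- `C01 : e1·e1 = e1 + e2, e2·e1 = e2`. -/
noncomputable def C01 : V2 →ₗ[ℂ] V2 →ₗ[ℂ] V2 := bil ![![e1 + e2, 0], ![e2, 0]]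

/-- `C02 : e1·e1 = e1 + e2, e1·e2 = e2`. -/
noncomputable def C02 : V2 →ₗ[ℂ] V2 →ₗ[ℂ] V2 := bil ![![e1 + e2, e2], ![0, 0]]

/-- `C03 : e1·e1 = e2`. -/
noncomputable def C03 : V2 →ₗ[ℂ] V2 →ₗ[ℂ] V2 := bil ![![e2, 0], ![0, 0]]

/-- `C04 : e2·e1 = e1`. -/
noncomputable def C04 : V2 →ₗ[ℂ] V2 →ₗ[ℂ] V2 := bil ![![0, 0], ![e1, 0]]

/-- `C05^α : e1·e1 = e1, e1·e2 = α e2`. -/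
noncomputable def C05 (α : ℂ) : V2 →ₗ[ℂ] V2 →ₗ[ℂ] V2 := bil ![![e1, α • e2], ![0, 0]]

/-- `C06^α : e1·e1 = e1, e1·e2 = α e2, e2·e1 = e2`. -/
noncomputable def C06 (α : ℂ) : V2 →ₗ[ℂ] V2 →ₗ[ℂ] V2 := bil ![![e1, α • e2], ![e2, 0]]

/-- `C07 : e1·e1 = e1, e2·e2 = e2`. -/
noncomputable def C07 : V2 →ₗ[ℂ] V2 →ₗ[ℂ] V2 := bil ![![e1, 0], ![0, e2]]

/-- `C08 : e1·e1 = e1, e1·e2 = 2 e2, e2·e1 = (1/2) e1 + e2, e2·e2 = e2`. -/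
noncomputable def C08 : V2 →ₗ[ℂ] V2 →ₗ[ℂ] V2 :=
  bil ![![e1, (2 : ℂ) • e2], ![(1 / 2 : ℂ) • e1 + e2, e2]]

/-- The second multiplication of `C09^{α,β}`: `e1∗e1 = α e1, e1∗e2 = β e2, e2∗e1 = α e2`. -/
noncomputable def C09s (α β : ℂ) : V2 →ₗ[ℂ] V2 →ₗ[ℂ] V2 :=
  bil ![![α • e1, β • e2], ![α • e2, 0]]

/-- The second multiplication of `C10^{α,β}`: `e1∗e1 = α e1 + β e2, e2∗e1 = α e2`. -/
noncomputable def C10s (α β : ℂ) : V2 →ₗ[ℂ] V2 →ₗ[ℂ] V2 :=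
  bil ![![α • e1 + β • e2, 0], ![α • e2, 0]]

/-- The second multiplication of `C11^{α,β}`: `e1∗e1 = α e1, e1∗e2 = β e2`. -/
noncomputable def C11s (α β : ℂ) : V2 →ₗ[ℂ] V2 →ₗ[ℂ] V2 :=
  bil ![![α • e1, β • e2], ![0, 0]]

/-- The second multiplication of `C12^{α,β}`: `e1∗e1 = α e1 + β e2, e1∗e2 = α e2`. -/
noncomputable def C12s (α β : ℂ) : V2 →ₗ[ℂ] V2 →ₗ[ℂ] V2 :=
  bil ![![α • e1 + β • e2, α • e2], ![0, 0]]

/-- The second multiplication of `C13^α`: `e1∗e1 = α e1, e1∗e2 = e2, e2∗e1 = α e2`. -/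
noncomputable def C13s (α : ℂ) : V2 →ₗ[ℂ] V2 →ₗ[ℂ] V2 :=
  bil ![![α • e1, e2], ![α • e2, 0]]

/-- The second multiplication of `C14^α`: `e1∗e1 = e1 + α e2, e2∗e1 = e2`. -/
noncomputable def C14s (α : ℂ) : V2 →ₗ[ℂ] V2 →ₗ[ℂ] V2 :=
  bil ![![e1 + α • e2, 0], ![e2, 0]]

/-- The second multiplication of `C15^α`: `e1∗e1 = α e2`. -/
noncomputable def C15s (α : ℂ) : V2 →ₗ[ℂ] V2 →ₗ[ℂ] V2 :=
  bil ![![α • e2, 0], ![0, 0]]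

/-- The second multiplication of `C16^α`: `e1∗e1 = e1, e1∗e2 = α e2`. -/
noncomputable def C16s (α : ℂ) : V2 →ₗ[ℂ] V2 →ₗ[ℂ] V2 :=
  bil ![![e1, α • e2], ![0, 0]]

/-- The second multiplication of `C17^α`: `e1∗e1 = e1 + α e2, e1∗e2 = e2`. -/
noncomputable def C17s (α : ℂ) : V2 →ₗ[ℂ] V2 →ₗ[ℂ] V2 :=
  bil ![![e1 + α • e2, e2], ![0, 0]]

/-- The second multiplication of `C18^α`: `e1∗e1 = α e2, e1∗e2 = e1, e2∗e1 = e1, e2∗e2 = e2`. -/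
noncomputable def C18s (α : ℂ) : V2 →ₗ[ℂ] V2 →ₗ[ℂ] V2 :=
  bil ![![α • e2, e1], ![e1, e2]]

/-- The second multiplication of `C19^α`: `e1∗e1 = α e2, e2∗e1 = e1, e2∗e2 = 2 e2`. -/
noncomputable def C19s (α : ℂ) : V2 →ₗ[ℂ] V2 →ₗ[ℂ] V2 :=
  bil ![![α • e2, 0], ![e1, (2 : ℂ) • e2]]

/-- The second multiplication of `C20^{α,β}`: `e2∗e1 = α e1, e2∗e2 = e1 + β e2`. -/
noncomputable def C20s (α β : ℂ) : V2 →ₗ[ℂ] V2 →ₗ[ℂ] V2 :=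
  bil ![![0, 0], ![α • e1, e1 + β • e2]]

/-- The second multiplication of `C21^{α,β}`: `e2∗e1 = α e1, e2∗e2 = β e2`. -/
noncomputable def C21s (α β : ℂ) : V2 →ₗ[ℂ] V2 →ₗ[ℂ] V2 :=
  bil ![![0, 0], ![α • e1, β • e2]]

/-- The second multiplication of `C22^{α,β}`: `e1∗e2 = α e1, e2∗e1 = β e1, e2∗e2 = e1 + α e2`. -/
noncomputable def C22s (α β : ℂ) : V2 →ₗ[ℂ] V2 →ₗ[ℂ] V2 :=
  bil ![![0, α • e1], ![β • e1, e1 + α • e2]]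

/-- The second multiplication of `C23^{α,β}`: `e1∗e2 = α e1, e2∗e1 = β e1, e2∗e2 = α e2`. -/
noncomputable def C23s (α β : ℂ) : V2 →ₗ[ℂ] V2 →ₗ[ℂ] V2 :=
  bil ![![0, α • e1], ![β • e1, α • e2]]

/-- The second multiplication of `C24^{α,β,γ}`: `e1∗e1 = β e1 + e2, e1∗e2 = γ e2`. -/
noncomputable def C24s (β γ : ℂ) : V2 →ₗ[ℂ] V2 →ₗ[ℂ] V2 :=
  bil ![![β • e1 + e2, γ • e2], ![0, 0]]

/-- The second multiplication of `C25^{α,β,γ}`: `e1∗e1 = β e1, e1∗e2 = γ e2`. -/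
noncomputable def C25s (β γ : ℂ) : V2 →ₗ[ℂ] V2 →ₗ[ℂ] V2 :=
  bil ![![β • e1, γ • e2], ![0, 0]]

/-- The second multiplication of `C29^α`: `e1∗e1 = α e1, e2∗e2 = e2`. -/
noncomputable def C29s (α : ℂ) : V2 →ₗ[ℂ] V2 →ₗ[ℂ] V2 :=
  bil ![![α • e1, 0], ![0, e2]]

/-- The second multiplication of `C30^{α,β}`:
`e1∗e1 = α e1 + β e2, e1∗e2 = e1, e2∗e1 = e1, e2∗e2 = e2`. -/
noncomputable def C30s (α β : ℂ) : V2 →ₗ[ℂ] V2 →ₗ[ℂ] V2 :=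
  bil ![![α • e1 + β • e2, e1], ![e1, e2]]

/-- The second multiplication of `C31^{α,β,γ}`:
`e1∗e1 = β e1 + e2, e1∗e2 = γ e2, e2∗e1 = β e2`. -/
noncomputable def C31s (β γ : ℂ) : V2 →ₗ[ℂ] V2 →ₗ[ℂ] V2 :=
  bil ![![β • e1 + e2, γ • e2], ![β • e2, 0]]

/-- The second multiplication of `C32^{α,β,γ}`:
`e1∗e1 = β e1, e1∗e2 = γ e2, e2∗e1 = β e2`. -/
noncomputable def C32s (β γ : ℂ) : V2 →ₗ[ℂ] V2 →ₗ[ℂ] V2 :=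
  bil ![![β • e1, γ • e2], ![β • e2, 0]]

/-- The second multiplication of `C34^{α,β}`:
`e1∗e1 = α e1, e1∗e2 = α e2, e2∗e1 = α e2, e2∗e2 = e1 + β e2`. -/
noncomputable def C34s (α β : ℂ) : V2 →ₗ[ℂ] V2 →ₗ[ℂ] V2 :=
  bil ![![α • e1, α • e2], ![α • e2, e1 + β • e2]]

/-- The second multiplication of `C35^α`:
`e1∗e1 = α e1, e1∗e2 = α e2, e2∗e1 = α e2, e2∗e2 = e2`. -/
noncomputable def C35s (α : ℂ) : V2 →ₗ[ℂ] V2 →ₗ[ℂ] V2 :=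
  bil ![![α • e1, α • e2], ![α • e2, e2]]

/-- The second multiplication of `C38^{α,β,γ}`:
`e1∗e1 = (γ+β−α) e1 − β e2, e1∗e2 = α e1 + β e2, e2∗e1 = α e1 + β e2, e2∗e2 = −α e1 + γ e2`. -/
noncomputable def C38s (α β γ : ℂ) : V2 →ₗ[ℂ] V2 →ₗ[ℂ] V2 :=
  bil ![![(γ + β - α) • e1 - β • e2, α • e1 + β • e2],
        ![α • e1 + β • e2, (-α) • e1 + γ • e2]]

/-- The second multiplication of `C39^{α,β}`: `e1∗e1 = α e1, e2∗e2 = β e2`. -/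
noncomputable def C39s (α β : ℂ) : V2 →ₗ[ℂ] V2 →ₗ[ℂ] V2 :=
  bil ![![α • e1, 0], ![0, β • e2]]

/-- The second multiplication of `C40^{α,β,γ}`:
`e1∗e1 = α e1 + β e2, e1∗e2 = 2α e2, e2∗e1 = γ e1 + α e2, e2∗e2 = 2γ e2`. -/
noncomputable def C40s (α β γ : ℂ) : V2 →ₗ[ℂ] V2 →ₗ[ℂ] V2 :=
  bil ![![α • e1 + β • e2, (2 * α) • e2], ![γ • e1 + α • e2, (2 * γ) • e2]]

/-- The second multiplication of `C41^{α,β}`: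
`e1∗e1 = α e1, e1∗e2 = β e1 + 2α e2, e2∗e1 = (2β + α/2) e1 + α e2,
e2∗e2 = (β/2) e1 + (α+β) e2`. -/
noncomputable def C41s (α β : ℂ) : V2 →ₗ[ℂ] V2 →ₗ[ℂ] V2 :=
  bil ![![α • e1, β • e1 + (2 * α) • e2],
        ![(2 * β + α / 2) • e1 + α • e2, (β / 2) • e1 + (α + β) • e2]]

theorem bil_apply (f : Fin 2 → Fin 2 → V2) (x y : V2) (k : Fin 2) :
    bil f x y k = x 0 * y 0 * f 0 0 k + x 0 * y 1 * f 0 1 k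
      + (x 1 * y 0 * f 1 0 k + x 1 * y 1 * f 1 1 k) := by
  simp [bil]

theorem eq_bil (ν : V2 →ₗ[ℂ] V2 →ₗ[ℂ] V2) :
    ν = bil ![![ν e1 e1, ν e1 e2], ![ν e2 e1, ν e2 e2]] := by
  have hV : ∀ x : V2, x = x 0 • e1 + x 1 • e2 := fun x => by
    ext i
    fin_cases i <;> simp [e1, e2]
  refine LinearMap.ext₂ fun x y => ?_
  conv_lhs => rw [hV x, hV y]
  ext k
  simp only [map_add, map_smul, LinearMap.add_apply, LinearMap.smul_apply, Pi.add_apply,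
    Pi.smul_apply, smul_eq_mul, bil_apply]
  simp
  ring

/-- The normal form, up to the condition `b = 0 ∨ k = b`, of multiplications compatible with `C04`:
`e1∗e2 = b e1, e2∗e1 = c e1, e2∗e2 = d e1 + k e2`. -/
noncomputable def compatC04 (b c d k : ℂ) : V2 →ₗ[ℂ] V2 →ₗ[ℂ] V2 :=
  bil ![![0, b • e1], ![c • e1, d • e1 + k • e2]]

theorem eq_compatC04_of_isCompatPreLie {ν : V2 →ₗ[ℂ] V2 →ₗ[ℂ] V2}
    (h : IsCompatPreLie C04 ν) :
    ∃ b c d k : ℂ, ν = compatC04 b c d k ∧ (b = 0 ∨ k = b) := by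
  obtain ⟨-, hν, hsum⟩ := h
  rw [eq_bil ν] at hν hsum ⊢
  generalize ν e1 e1 = u at *
  generalize ν e1 e2 = v at *
  generalize ν e2 e1 = w at *
  generalize ν e2 e2 = z at *
  have n10 := congrFun (hν e1 e2 e1) 0
  have n11 := congrFun (hν e1 e2 e1) 1
  have n20 := congrFun (hν e1 e2 e2) 0
  have n21 := congrFun (hν e1 e2 e2) 1
  have s10 := congrFun (hsum e1 e2 e1) 0
  have s11 := congrFun (hsum e1 e2 e1) 1
  have s20 := congrFun (hsum e1 e2 e2) 0
  have s21 := congrFun (hsum e1 e2 e2) 1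
  simp [C04, bil_apply, e1, e2] at n10 n11 n20 n21 s10 s11 s20 s21
  have hu1 : u 1 = 0 := by linear_combination (n11 - s11) / 2
  have hv1 : v 1 = 0 := by linear_combination n21 - s21
  have hu0 : u 0 = -w 1 := by linear_combination n10 - s10 + hv1
  have hw1 : w 1 = 0 := by
    have : w 1 ^ 2 = 0 := by
      rw [hu1, hv1, hu0] at n11
      linear_combination -n11 / 2
    simpa using this
  rw [hw1, neg_zero] at hu0
  refine ⟨v 0, w 0, z 0, z 1, ?_, ?_⟩
  · unfold compatC04
    congr
    all_goals
      ext i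
      fin_cases i <;> simp [e1, e2, *]
  · have : v 0 * (z 1 - v 0) = 0 := by
      rw [hu0, hv1, hw1] at n20
      linear_combination -n20
    simpa [sub_eq_zero] using this

theorem compatIso_compatC04_smul {t : ℂ} (ht : t ≠ 0) (b c d k : ℂ) :
    CompatIso C04 (compatC04 b c d k) C04 (compatC04 b c (t * d) k) := by
  have hs : ∀ i : Fin 2, (![t, 1] : V2) i ≠ 0 := fun i => by
    fin_cases i <;> simp [ht]
  refine ⟨LinearEquiv.piCongrRight fun i => LinearEquiv.smulOfNeZero ℂ ℂ _ (hs i), ?_, ?_⟩ <;>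
  · intro x y
    ext i
    fin_cases i <;> simp [C04, compatC04, bil_apply, e1, e2]
    ring

/-- Every compatible pre-Lie algebra whose first multiplication is `C04`
(`e2·e1 = e1`) is isomorphic to some `C20^{α,β}`, `C21^{α,β}`, `C22^{α,β}` (`α ≠ 0`)
or `C23^{α,β}` (`α ≠ 0`). -/
theorem compatible_preLie_on_C04 (ν : V2 →ₗ[ℂ] V2 →ₗ[ℂ] V2)
    (h : IsCompatPreLie C04 ν) :
    (∃ α β : ℂ, CompatIso C04 ν C04 (C20s α β)) ∨
      (∃ α β : ℂ, CompatIso C04 ν C04 (C21s α β)) ∨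
      (∃ α β : ℂ, α ≠ 0 ∧ CompatIso C04 ν C04 (C22s α β)) ∨
      (∃ α β : ℂ, α ≠ 0 ∧ CompatIso C04 ν C04 (C23s α β)) := by
  obtain ⟨b, c, d, k, rfl, hb⟩ := eq_compatC04_of_isCompatPreLie h
  by_cases hd : d = 0
  · subst hd
    have key := compatIso_compatC04_smul one_ne_zero b c 0 k
    rw [mul_zero] at key
    by_cases hb0 : b = 0
    · refine .inr (.inl ⟨c, k, ?_⟩)
      simpa [compatC04, C21s, hb0] using key
    · obtain rfl := hb.resolve_left hb0
      refine .inr (.inr (.inr ⟨k, c, hb0, ?_⟩))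
      simpa [compatC04, C23s] using key
  · have key := compatIso_compatC04_smul (inv_ne_zero hd) b c d k
    rw [inv_mul_cancel₀ hd] at key
    by_cases hb0 : b = 0
    · refine .inl ⟨c, k, ?_⟩
      simpa [compatC04, C20s, hb0] using key
    · obtain rfl := hb.resolve_left hb0
      refine .inr (.inr (.inl ⟨k, c, hb0, ?_⟩))
      simpa [compatC04, C22s] using key
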